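/- For every ε > 0 there exists a constant C(ε) > 0 such that for all integers 1 ≤ k ≤ n, every probability vector p ∈ (0,1)^n with p_1 ≤ … ≤ p_n, and all integers a, a' with 1 ≤ a < a' ≤ n, there exists a family Π of partial non-adaptive policies, each of length at most a', with |Π| ≤ n^{C(ε)·a'/a}, such that for every non-adaptive policy π* there is some π ∈ Π with Pr[cost(π) ≥ i] ≤ Pr[(1+ε)·cost(π*) ≥ i] for every integer i with a ≤ i ≤ a'. -/

import Mathlib

open Finset

/-- Among the first `ℓ` tests of the partial non-adaptive policy `σ` on outcome `x`,
there are at least `k` ones or at least `n−k+1` zeros. -/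
def Stops (n k : ℕ) (σ : List (Fin n)) (x : Fin n → Bool) (ℓ : ℕ) : Prop :=
  k ≤ ((σ.take ℓ).filter fun i => x i).length ∨
    n - k + 1 ≤ ((σ.take ℓ).filter fun i => !x i).length

open Classical in
/-- The cost of a partial non-adaptive policy `σ` on outcome `x`: the least `ℓ ≤ length σ`
with at least `k` ones or at least `n−k+1` zeros among the first `ℓ` tests, and `n` if no
such `ℓ` exists. -/
noncomputable def cost (n k : ℕ) (σ : List (Fin n)) (x : Fin n → Bool) : ℕ :=
  if ∃ ℓ ≤ σ.length, Stops n k σ x ℓ then sInf {ℓ | Stops n k σ x ℓ} else n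

open Classical in
/-- `Pr[P]` with respect to the product measure on `{0,1}^n` where `Pr[x_i = 1] = p_i`. -/
noncomputable def pr {n : ℕ} (p : Fin n → ℝ) (P : (Fin n → Bool) → Prop) : ℝ :=
  ∑ x : Fin n → Bool, if P x then (∏ i, if x i then p i else 1 - p i) else 0

/-- The probability that a Boolean variable with success probability `p i` takes value `β`. -/
def bprob {ι : Type*} (p : ι → ℝ) (β : Bool) (i : ι) : ℝ := if β then p i else 1 - p i

/-- Two-sided dominance: for each outcome `β` and threshold `c`, the list `l'` has at least as
many tests as `l` that take value `β` with probability at least `c`. -/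
def Dominated {ι : Type*} (p : ι → ℝ) (l l' : List ι) : Prop :=
  ∀ (β : Bool) (c : ℝ),
    l.countP (fun i => decide (c ≤ bprob p β i)) ≤ l'.countP (fun i => decide (c ≤ bprob p β i))

/-- Every finite list of tests misses, unless it is full, a test that is nearest to `m` from
both sides. -/
theorem exists_near {ι : Type*} [Finite ι] (p : ι → ℝ) (σ : List ι) (m : ι)
    (hσ : ∃ u, u ∉ σ) :
    ∃ e ∉ σ, ∀ u ∉ σ, ∀ β, bprob p β u ≤ bprob p β m → bprob p β u ≤ bprob p β e := by
  by_cases h : ∃ u, u ∉ σ ∧ p u ≤ p m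
  · obtain ⟨e, he, hmax⟩ := Set.exists_max_image {u | u ∉ σ ∧ p u ≤ p m} p (Set.toFinite _) h
    refine ⟨e, he.1, fun u hu β hβ => ?_⟩
    cases β
    · have := he.2
      simp only [bprob, Bool.false_eq_true, if_false] at hβ ⊢
      linarith
    · simp only [bprob, if_true] at hβ ⊢
      exact hmax u ⟨hu, hβ⟩
  · obtain ⟨e, he, hmin⟩ := Set.exists_min_image {u | u ∉ σ} p (Set.toFinite _) hσ
    refine ⟨e, he, fun u hu β hβ => ?_⟩
    cases β
    · have := hmin u hu
      simp only [bprob, Bool.false_eq_true, if_false]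
      linarith
    · exact absurd ⟨u, hu, hβ⟩ h

open Classical in
/-- Append to `σ` an unused test nearest to `m`, if there is an unused test. -/
noncomputable def addNear {ι : Type*} (p : ι → ℝ) (σ : List ι) (m : ι) : List ι :=
  if h : ∃ e ∉ σ, ∀ u ∉ σ, ∀ β, bprob p β u ≤ bprob p β m → bprob p β u ≤ bprob p β e then
    σ ++ [h.choose] else σ

/-- The policy obtained by successively appending tests nearest to the targets `ms`. -/
noncomputable def placement {ι : Type*} (p : ι → ℝ) (ms : List ι) : List ι :=
  ms.foldl (addNear p) []

theorem placement_concat {ι : Type*} (p : ι → ℝ) (ms : List ι) (m : ι) :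
    placement p (ms ++ [m]) = addNear p (placement p ms) m := by
  simp [placement]

theorem isPrefix_addNear {ι : Type*} (p : ι → ℝ) (σ : List ι) (m : ι) : σ <+: addNear p σ m := by
  unfold addNear
  split_ifs
  · exact List.prefix_append _ _
  · exact List.prefix_rfl

theorem nodup_placement {ι : Type*} (p : ι → ℝ) (ms : List ι) : (placement p ms).Nodup := by
  induction ms using List.reverseRecOn with
  | nil => simp [placement]
  | append_singleton ms m ih =>
    rw [placement_concat, addNear]
    split_ifs with h
    · rw [List.nodup_append]
      exact ⟨ih, List.nodup_singleton _, fun a ha b hb hab =>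
        h.choose_spec.1 (by rwa [hab, List.mem_singleton.1 hb] at ha)⟩
    · exact ih

theorem length_placement_le {ι : Type*} (p : ι → ℝ) (ms : List ι) :
    (placement p ms).length ≤ ms.length := by
  induction ms using List.reverseRecOn with
  | nil => simp [placement]
  | append_singleton ms m ih =>
    rw [placement_concat, addNear]
    split_ifs <;> simp <;> omega

theorem placement_isPrefix_append {ι : Type*} (p : ι → ℝ) (ms ms' : List ι) :
    placement p ms <+: placement p (ms ++ ms') := by
  induction ms' using List.reverseRecOn with
  | nil => simp
  | append_singleton l m ih =>
    rw [← List.append_assoc, placement_concat]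
    exact ih.trans (isPrefix_addNear _ _ _)

theorem countP_le_countP_placement {ι : Type*} [Finite ι] (p : ι → ℝ) (ms : List ι) (u : ι)
    (hu : u ∉ placement p ms) (β : Bool) :
    ms.countP (fun i => decide (bprob p β u ≤ bprob p β i)) ≤
      (placement p ms).countP (fun i => decide (bprob p β u ≤ bprob p β i)) := by
  induction ms using List.reverseRecOn with
  | nil => simp
  | append_singleton ms m ih =>
    have hu' : u ∉ placement p ms := fun h =>
      hu (by rw [placement_concat]; exact (isPrefix_addNear p _ m).subset h)
    have h := exists_near p (placement p ms) m ⟨u, hu'⟩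
    have hspec := h.choose_spec.2 u hu' β
    rw [placement_concat, addNear, dif_pos h, List.countP_append, List.countP_append]
    refine Nat.add_le_add (ih hu') ?_
    by_cases hm : bprob p β u ≤ bprob p β m
    · rw [List.countP_singleton, List.countP_singleton, if_pos (by simpa using hm),
        if_pos (decide_eq_true (hspec hm))]
    · simp [hm]

theorem List.countP_eq_card_filter_toFinset {ι : Type*} [DecidableEq ι] {l : List ι}
    (hl : l.Nodup) (P : ι → Prop) [DecidablePred P] :
    l.countP (fun i => decide (P i)) = #{i ∈ l.toFinset | P i} := by
  rw [List.countP_eq_length_filter, ← List.toFinset_card_of_nodup (hl.filter _),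
    List.toFinset_filter]
  simp

/-- Comparing counts at thresholds outside `T` is enough to compare them at all thresholds. -/
theorem card_filter_le_of_forall_notMem {ι : Type*} [DecidableEq ι] (q : ι → ℝ) (S T : Finset ι)
    (h : ∀ u ∉ T, #{s ∈ S | q u ≤ q s} ≤ #{t ∈ T | q u ≤ q t}) (c : ℝ) :
    #{s ∈ S | c ≤ q s} ≤ #{t ∈ T | c ≤ q t} := by
  have key : ∀ A B : Finset ι, ∀ c : ℝ, #{s ∈ A | c ≤ q s} =
      #{s ∈ A \ B | c ≤ q s} + #{s ∈ A ∩ B | c ≤ q s} := by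
    intro A B c
    rw [← card_union_of_disjoint, ← filter_union, sdiff_union_inter]
    exact disjoint_filter_filter (disjoint_sdiff_inter A B)
  have key' : ∀ c : ℝ, #{s ∈ S | c ≤ q s} ≤ #{t ∈ T | c ≤ q t} ↔
      #{s ∈ S \ T | c ≤ q s} ≤ #{t ∈ T \ S | c ≤ q t} := by
    intro c
    rw [key S T, key T S, inter_comm T S]
    omega
  rw [key']
  rcases eq_empty_or_nonempty {s ∈ S \ T | c ≤ q s} with h0 | hne
  · simp [h0]
  · obtain ⟨u, hu, hmin⟩ := exists_min_image _ q hne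
    simp only [mem_filter, mem_sdiff] at hu hmin
    calc #{s ∈ S \ T | c ≤ q s} ≤ #{s ∈ S \ T | q u ≤ q s} := by
          refine card_le_card fun s hs => ?_
          simp only [mem_filter, mem_sdiff] at hs ⊢
          exact ⟨hs.1, hmin s hs⟩
      _ ≤ #{t ∈ T \ S | q u ≤ q t} := (key' _).1 (h u hu.1.2)
      _ ≤ #{t ∈ T \ S | c ≤ q t} := by
          refine card_le_card fun s hs => ?_
          simp only [mem_filter, mem_sdiff] at hs ⊢
          exact ⟨hs.1, hu.2.trans hs.2⟩

theorem Dominated.placement {ι : Type*} [Finite ι] {p : ι → ℝ} {l ms : List ι} (hl : l.Nodup)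
    (h : Dominated p l ms) : Dominated p l (placement p ms) := by
  classical
  intro β c
  have hn := nodup_placement p ms
  rw [List.countP_eq_card_filter_toFinset hl, List.countP_eq_card_filter_toFinset hn]
  refine card_filter_le_of_forall_notMem _ _ _ (fun u hu => ?_) c
  rw [← List.countP_eq_card_filter_toFinset hl, ← List.countP_eq_card_filter_toFinset hn]
  exact (h β _).trans (countP_le_countP_placement p ms u (by simpa using hu) β)

theorem pr_mono {n : ℕ} {p : Fin n → ℝ} (hp : ∀ i, 0 < p i ∧ p i < 1)
    {P R : (Fin n → Bool) → Prop} (h : ∀ x, P x → R x) : pr p P ≤ pr p R := by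
  refine sum_le_sum fun x _ => ?_
  have hw : 0 ≤ ∏ i, (if x i then p i else 1 - p i) := prod_nonneg fun i _ => by
    have := hp i
    split_ifs <;> linarith
  by_cases hP : P x
  · simp [hP, h x hP]
  · rw [if_neg hP]
    split_ifs
    exacts [hw, le_rfl]

theorem pr_split {n : ℕ} (p : Fin n → ℝ) (s : Fin n) (β : Bool)
    {P A B : (Fin n → Bool) → Prop}
    (hA : ∀ x c, A (Function.update x s c) ↔ A x) (hB : ∀ x c, B (Function.update x s c) ↔ B x)
    (hPA : ∀ x, x s = β → (P x ↔ A x)) (hPB : ∀ x, x s ≠ β → (P x ↔ B x)) :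
    pr p P = bprob p β s * pr p A + (1 - bprob p β s) * pr p B := by
  classical
  have expand : ∀ R : (Fin n → Bool) → Prop, pr p R = ∑ y : {j // j ≠ s} → Bool,
      (∏ j : {j // j ≠ s}, if y j then p j else 1 - p j) *
      ((if R ((Equiv.funSplitAt s Bool).symm (β, y)) then bprob p β s else 0) +
        if R ((Equiv.funSplitAt s Bool).symm (!β, y)) then 1 - bprob p β s else 0) := by
    intro R
    have hw : ∀ c y, (∏ i, if (Equiv.funSplitAt s Bool).symm (c, y) i then p i else 1 - p i) =
        bprob p c s * ∏ j : {j // j ≠ s}, if y j then p j else 1 - p j := by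
      intro c y
      rw [Fintype.prod_eq_mul_prod_subtype_ne _ s]
      congr 1
      · simp [bprob]
      · refine prod_congr rfl fun j _ => ?_
        simp [j.2]
    rw [pr, ← (Equiv.funSplitAt s Bool).symm.sum_comp, Fintype.sum_prod_type_right]
    refine sum_congr rfl fun y _ => ?_
    rw [Fintype.sum_bool, hw, hw]
    cases β <;> simp [bprob] <;> split_ifs <;> ring
  have upd : ∀ c c' y, (Equiv.funSplitAt s Bool).symm (c, y) =
      Function.update ((Equiv.funSplitAt s Bool).symm (c', y)) s c := by
    intro c c' y
    ext j
    by_cases hj : j = s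
    · subst hj; simp
    · simp [hj]
  rw [expand P, expand A, expand B, mul_sum, mul_sum, ← sum_add_distrib]
  refine sum_congr rfl fun y _ => ?_
  have e1 := hPA ((Equiv.funSplitAt s Bool).symm (β, y)) (by simp)
  have e2 := hPB ((Equiv.funSplitAt s Bool).symm (!β, y)) (by simp)
  have e3 : A ((Equiv.funSplitAt s Bool).symm (!β, y)) ↔
      A ((Equiv.funSplitAt s Bool).symm (β, y)) := by rw [upd _ β, hA]
  have e4 : B ((Equiv.funSplitAt s Bool).symm (!β, y)) ↔
      B ((Equiv.funSplitAt s Bool).symm (β, y)) := by rw [upd _ β, hB]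
  simp only [e1, e2, e3, e4]
  split_ifs <;> ring

theorem pr_le_card_filter_insert {n : ℕ} (p : Fin n → ℝ) (β : Bool) (k : ℕ) {s : Fin n}
    {S : Finset (Fin n)} (hs : s ∉ S) :
    pr p (fun x => k + 1 ≤ #{i ∈ insert s S | x i = β}) =
      bprob p β s * pr p (fun x => k ≤ #{i ∈ S | x i = β}) +
        (1 - bprob p β s) * pr p (fun x => k + 1 ≤ #{i ∈ S | x i = β}) := by
  have hupd : ∀ (x : Fin n → Bool) c,
      ({i ∈ S | Function.update x s c i = β} : Finset _) = {i ∈ S | x i = β} := by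
    intro x c
    refine filter_congr fun i hi => ?_
    rw [Function.update_of_ne (by rintro rfl; exact hs hi)]
  refine pr_split p s β (fun x c => by rw [hupd]) (fun x c => by rw [hupd]) ?_ ?_
  · intro x hx
    rw [filter_insert, if_pos hx, card_insert_of_notMem (by simp [hs])]
    omega
  · intro x hx
    rw [filter_insert, if_neg hx]

theorem pr_le_card_filter_mono {n : ℕ} {p : Fin n → ℝ} (hp : ∀ i, 0 < p i ∧ p i < 1) (β : Bool)
    (k : ℕ) (S T : Finset (Fin n))
    (h : ∀ c : ℝ, #{s ∈ S | c ≤ bprob p β s} ≤ #{t ∈ T | c ≤ bprob p β t}) :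
    pr p (fun x => k ≤ #{i ∈ S | x i = β}) ≤ pr p (fun x => k ≤ #{i ∈ T | x i = β}) := by
  induction hm : #S generalizing S T k with
  | zero =>
    refine pr_mono hp fun x hx => ?_
    rw [card_eq_zero] at hm
    subst hm
    simp only [filter_empty, card_empty] at hx
    omega
  | succ m ih =>
    cases k with
    | zero => exact pr_mono hp fun x _ => Nat.zero_le _
    | succ k =>
    obtain ⟨s, hs, hsmax⟩ := exists_max_image S (bprob p β) (card_pos.1 (by omega))
    have hTs : 0 < #{t ∈ T | bprob p β s ≤ bprob p β t} :=
      (card_pos.2 ⟨s, by simp [hs]⟩).trans_le (h _)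
    obtain ⟨t', ht'⟩ := card_pos.1 hTs
    rw [mem_filter] at ht'
    obtain ⟨t, ht, htmax⟩ := exists_max_image T (bprob p β) ⟨t', ht'.1⟩
    have hst : bprob p β s ≤ bprob p β t := ht'.2.trans (htmax t' ht'.1)
    have hdom : ∀ c : ℝ, #{i ∈ S.erase s | c ≤ bprob p β i} ≤
        #{i ∈ T.erase t | c ≤ bprob p β i} := by
      intro c
      by_cases hc : c ≤ bprob p β s
      · rw [filter_erase, filter_erase, card_erase_of_mem (by simp [hs, hc]),
          card_erase_of_mem (by simp [ht, hc.trans hst])]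
        exact Nat.sub_le_sub_right (h c) 1
      · rw [filter_false_of_mem]
        · simp
        · intro i hi hci
          exact hc (hci.trans (hsmax i (mem_of_mem_erase hi)))
    have hcard : #(S.erase s) = m := by rw [card_erase_of_mem hs, hm]; rfl
    have h0 := ih k _ _ hdom hcard
    have h1 := ih (k + 1) _ _ hdom hcard
    have hanti : pr p (fun x => k + 1 ≤ #{i ∈ S.erase s | x i = β}) ≤
        pr p (fun x => k ≤ #{i ∈ S.erase s | x i = β}) := pr_mono hp fun x hx => by omega
    have ht0 : 0 ≤ bprob p β t ∧ bprob p β t ≤ 1 := by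
      have := hp t
      cases β <;> simp [bprob] <;> constructor <;> linarith
    rw [← insert_erase hs, ← insert_erase ht, pr_le_card_filter_insert p β k (notMem_erase s S),
      pr_le_card_filter_insert p β k (notMem_erase t T)]
    nlinarith [mul_le_mul_of_nonneg_left h0 ht0.1,
      mul_le_mul_of_nonneg_left h1 (sub_nonneg.2 ht0.2),
      mul_nonneg (sub_nonneg.2 hst) (sub_nonneg.2 hanti)]

theorem pr_not_stops_add {n k : ℕ} (p : Fin n → ℝ) {σ : List (Fin n)} (hσ : σ.Nodup) (ℓ : ℕ) :
    pr p (fun x => ¬ Stops n k σ x ℓ) +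
        (pr p (fun x => k ≤ #{i ∈ (σ.take ℓ).toFinset | x i = true}) +
          pr p (fun x => n - k + 1 ≤ #{i ∈ (σ.take ℓ).toFinset | x i = false})) =
      pr p fun _ => True := by
  simp only [pr, ← sum_add_distrib]
  refine sum_congr rfl fun x _ => ?_
  have hnd : (σ.take ℓ).Nodup := hσ.sublist (List.take_sublist _ _)
  have h1 : ((σ.take ℓ).filter fun i => x i).length =
      #{i ∈ (σ.take ℓ).toFinset | x i = true} := by
    rw [← List.countP_eq_card_filter_toFinset hnd, List.countP_eq_length_filter]
    simp
  have h2 : ((σ.take ℓ).filter fun i => !x i).length =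
      #{i ∈ (σ.take ℓ).toFinset | x i = false} := by
    rw [← List.countP_eq_card_filter_toFinset hnd, List.countP_eq_length_filter]
    congr 2
    ext i
    cases x i <;> rfl
  have hle : #{i ∈ (σ.take ℓ).toFinset | x i = true} +
      #{i ∈ (σ.take ℓ).toFinset | x i = false} ≤ n := by
    rw [← card_union_of_disjoint (disjoint_filter.2 fun i _ h => by simp [h])]
    exact (card_le_univ _).trans (by simp)
  simp only [Stops, h1, h2]
  split_ifs <;> first | omega | simp

theorem pr_not_stops_le {n k : ℕ} {p : Fin n → ℝ} (hp : ∀ i, 0 < p i ∧ p i < 1)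
    {σ τ : List (Fin n)} (hσ : σ.Nodup) (hτ : τ.Nodup) {ℓ m : ℕ}
    (h : Dominated p (τ.take m) (σ.take ℓ)) :
    pr p (fun x => ¬ Stops n k σ x ℓ) ≤ pr p (fun x => ¬ Stops n k τ x m) := by
  have hmono : ∀ β k, pr p (fun x => k ≤ #{i ∈ (τ.take m).toFinset | x i = β}) ≤
      pr p (fun x => k ≤ #{i ∈ (σ.take ℓ).toFinset | x i = β}) := by
    intro β k
    refine pr_le_card_filter_mono hp β k _ _ fun c => ?_
    rw [← List.countP_eq_card_filter_toFinset (hτ.sublist (List.take_sublist _ _)),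
      ← List.countP_eq_card_filter_toFinset (hσ.sublist (List.take_sublist _ _))]
    exact h β c
  have e1 := pr_not_stops_add (k := k) p hσ ℓ
  have e2 := pr_not_stops_add (k := k) p hτ m
  linarith [hmono true k, hmono false (n - k + 1)]

theorem Stops.mono {n k : ℕ} {σ : List (Fin n)} {x : Fin n → Bool} {ℓ ℓ' : ℕ} (h : ℓ ≤ ℓ')
    (hs : Stops n k σ x ℓ) : Stops n k σ x ℓ' := by
  have hsub : (σ.take ℓ).Sublist (σ.take ℓ') := by
    exact List.take_sublist_take_left h
  exact hs.imp (fun h => h.trans (hsub.filter _).length_le)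
    (fun h => h.trans (hsub.filter _).length_le)

theorem cost_le_of_stops {n k : ℕ} {σ : List (Fin n)} {x : Fin n → Bool} {ℓ : ℕ}
    (hℓ : ℓ ≤ σ.length) (hs : Stops n k σ x ℓ) : cost n k σ x ≤ ℓ := by
  rw [cost, if_pos ⟨ℓ, hℓ, hs⟩]
  exact Nat.sInf_le hs

theorem lt_cost_of_not_stops {n k : ℕ} {σ : List (Fin n)} {x : Fin n → Bool} {ℓ : ℕ}
    (hℓ : ℓ < n) (hs : ¬ Stops n k σ x ℓ) : ℓ < cost n k σ x := by
  rw [cost]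
  split_ifs with h
  · obtain ⟨m, -, hm⟩ := h
    by_contra! hle
    exact hs (Stops.mono hle (Nat.sInf_mem (s := {ℓ | Stops n k σ x ℓ}) ⟨m, hm⟩))
  · exact hℓ

theorem pr_cost_placement_le {n k : ℕ} {p : Fin n → ℝ} (hp : ∀ i, 0 < p i ∧ p i < 1)
    {τ ms ms' : List (Fin n)} (hτ : τ.Nodup) {m i : ℕ} {r : ℝ} (hr : 0 ≤ r) (hm : m < n)
    (hdom : Dominated p (τ.take m) ms) (hms : ms.length < i) (hi : (i : ℝ) ≤ r * (m + 1)) :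
    pr p (fun x => i ≤ cost n k (placement p (ms ++ ms')) x) ≤
      pr p (fun x => (i : ℝ) ≤ r * (cost n k τ x : ℝ)) := by
  have hpre := placement_isPrefix_append p ms ms'
  have htake := List.prefix_iff_eq_take.1 hpre
  have hd := hdom.placement (hτ.sublist (List.take_sublist _ _))
  rw [htake] at hd
  calc pr p (fun x => i ≤ cost n k (placement p (ms ++ ms')) x)
      ≤ pr p (fun x => ¬ Stops n k (placement p (ms ++ ms')) x (placement p ms).length) := by
        refine pr_mono hp fun x hx hs => ?_
        have := cost_le_of_stops hpre.length_le hs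
        have := length_placement_le p ms
        omega
    _ ≤ pr p (fun x => ¬ Stops n k τ x m) := pr_not_stops_le hp (nodup_placement _ _) hτ hd
    _ ≤ _ := by
        refine pr_mono hp fun x hx => hi.trans (mul_le_mul_of_nonneg_left ?_ hr)
        exact_mod_cast lt_cost_of_not_stops hm hx

theorem Dominated.append {ι : Type*} {p : ι → ℝ} {l₁ l₂ m₁ m₂ : List ι}
    (h₁ : Dominated p l₁ m₁) (h₂ : Dominated p l₂ m₂) : Dominated p (l₁ ++ l₂) (m₁ ++ m₂) := by
  intro β c
  rw [List.countP_append, List.countP_append]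
  exact Nat.add_le_add (h₁ β c) (h₂ β c)

theorem exists_milestones_of_pairwise {ι : Type*} (p : ι → ℝ) {b : ℕ} (hb : 0 < b) (Q : ℕ)
    (D : List ι) (hD : D.Pairwise fun i j => p i ≤ p j) (hlen : D.length = Q * b) (lo : ι)
    (hlo : ∀ d ∈ D, p lo ≤ p d) :
    ∃ M : List ι, M.length = Q ∧ ∀ c : ℝ,
      D.countP (fun i => decide (c ≤ bprob p true i)) ≤
          (M.flatMap (List.replicate b)).countP (fun i => decide (c ≤ bprob p true i)) ∧
        D.countP (fun i => decide (c ≤ bprob p false i)) ≤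
          ((lo :: M).flatMap (List.replicate b)).countP
            (fun i => decide (c ≤ bprob p false i)) := by
  induction Q generalizing D lo with
  | zero =>
    have : D = [] := List.eq_nil_of_length_eq_zero (by simpa using hlen)
    exact ⟨[], rfl, fun c => by simp [this]⟩
  | succ Q ih =>
    obtain ⟨B, D', rfl, hB⟩ : ∃ B D', D = B ++ D' ∧ B.length = b :=
      ⟨D.take b, D.drop b, (List.take_append_drop b D).symm, by
        rw [List.length_take, hlen]; exact min_eq_left (Nat.le_mul_of_pos_left b Q.succ_pos)⟩
    obtain ⟨B', hi, rfl⟩ : ∃ B' hi, B = B' ++ [hi] :=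
      ⟨B.dropLast, B.getLast (by rintro rfl; simp at hB; omega),
        (List.dropLast_append_getLast _).symm⟩
    rw [List.pairwise_append] at hD
    obtain ⟨hB1, hD1, hBD⟩ := hD
    have hBhi : ∀ d ∈ B' ++ [hi], p d ≤ p hi := by
      intro d hd
      rw [List.pairwise_append] at hB1
      rcases List.mem_append.1 hd with h | h
      · exact hB1.2.2 d h hi (by simp)
      · rw [List.mem_singleton.1 h]
    obtain ⟨M, hM, hc⟩ := ih D' hD1
      (by rw [List.length_append, hB, Nat.succ_mul] at hlen; omega) hi
      (fun d hd => hBD hi (by simp) d hd)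
    refine ⟨hi :: M, by simp [hM], fun c => ⟨?_, ?_⟩⟩
    · rw [List.countP_append (l₁ := B' ++ [hi]), List.flatMap_cons,
        List.countP_append (l₁ := List.replicate b _)]
      refine Nat.add_le_add ?_ (hc c).1
      by_cases h : c ≤ bprob p true hi
      · rw [List.countP_replicate, if_pos (by simpa using h), ← hB]
        exact List.countP_le_length
      · rw [List.countP_eq_zero.2]
        · exact Nat.zero_le _
        · intro d hd
          have := hBhi d hd
          simp only [bprob, if_true, not_le, decide_eq_true_eq] at h ⊢
          linarith
    · rw [List.countP_append (l₁ := B' ++ [hi]), List.flatMap_cons,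
        List.countP_append (l₁ := List.replicate b _)]
      refine Nat.add_le_add ?_ (hc c).2
      by_cases h : c ≤ bprob p false lo
      · rw [List.countP_replicate, if_pos (by simpa using h), ← hB]
        exact List.countP_le_length
      · rw [List.countP_eq_zero.2]
        · exact Nat.zero_le _
        · intro d hd
          have := hlo d (List.mem_append_left _ hd)
          simp only [bprob, Bool.false_eq_true, if_false, not_le, decide_eq_true_eq] at h ⊢
          linarith

/-- A list of `Q * b` tests is dominated by `b` copies of each of `Q + 1` milestone tests. -/
theorem exists_milestones {ι : Type*} (p : ι → ℝ) {b Q : ℕ} (hb : 0 < b) (hQ : 0 < Q)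
    (D : List ι) (hlen : D.length = Q * b) :
    ∃ M : List ι, M.length = Q + 1 ∧ Dominated p D (M.flatMap (List.replicate b)) := by
  classical
  let R : ι → ι → Prop := fun i j => p i ≤ p j
  have : Std.Total R := ⟨fun i j => le_total (p i) (p j)⟩
  have : IsTrans ι R := ⟨fun i j k => le_trans⟩
  have hperm := List.perm_insertionSort R D
  have hsort := List.pairwise_insertionSort R D
  have hne : D ≠ [] := by
    rintro rfl
    have := Nat.mul_pos hQ hb
    simp at hlen
    omega
  obtain ⟨lo, -, hlo⟩ := exists_min_image D.toFinset p (by simpa using hne)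
  obtain ⟨M, hM, hc⟩ := exists_milestones_of_pairwise p hb Q (D.insertionSort R) hsort
    (by rw [hperm.length_eq, hlen]) lo (fun d hd => hlo d (by simpa using hperm.subset hd))
  refine ⟨lo :: M, by simp [hM], fun β c => ?_⟩
  rw [← hperm.countP_eq]
  cases β
  · exact (hc c).2
  · refine (hc c).1.trans ?_
    rw [List.flatMap_cons, List.countP_append]
    exact Nat.le_add_left _ _

/-- Milestones for `J` consecutive batches of `Q * b` tests each. -/
theorem exists_batch_milestones {ι : Type*} (p : ι → ℝ) {b Q : ℕ} (hb : 0 < b) (hQ : 0 < Q)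
    (τ : List ι) (J : ℕ) (hJ : J * (Q * b) ≤ τ.length) :
    ∃ M : List ι, M.length = J * (Q + 1) ∧ ∀ j ≤ J,
      Dominated p (τ.take (j * (Q * b))) ((M.take (j * (Q + 1))).flatMap (List.replicate b)) := by
  induction J with
  | zero =>
    refine ⟨[], by simp, fun j hj => ?_⟩
    obtain rfl : j = 0 := by omega
    intro β c
    simp
  | succ J ih =>
    have hJ' : J * (Q * b) + Q * b ≤ τ.length := by rwa [Nat.succ_mul] at hJ
    obtain ⟨M, hM, hdom⟩ := ih (by omega)
    obtain ⟨M', hM', hdom'⟩ := exists_milestones p hb hQ ((τ.drop (J * (Q * b))).take (Q * b))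
      (by rw [List.length_take, List.length_drop]; omega)
    refine ⟨M ++ M', by rw [List.length_append, hM, hM', Nat.succ_mul], fun j hj => ?_⟩
    rcases Nat.lt_or_ge J j with h | h
    · obtain rfl : j = J + 1 := by omega
      have h1 : (M ++ M').take ((J + 1) * (Q + 1)) = M ++ M' :=
        List.take_of_length_le (by rw [List.length_append, hM, hM', Nat.succ_mul])
      have h2 := hdom J le_rfl
      rw [List.take_of_length_le hM.le] at h2
      rw [h1, Nat.succ_mul, List.take_add, List.flatMap_append]
      exact h2.append hdom'
    · rw [List.take_append_of_le_length (by rw [hM]; exact Nat.mul_le_mul_right _ h)]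
      exact hdom j h

theorem List.length_flatMap_replicate {ι : Type*} (b : ℕ) (M : List ι) :
    (M.flatMap (List.replicate b)).length = M.length * b := by
  simp [List.length_flatMap]

open Classical in
/-- The policies obtained from `N` milestones, each used `b` times. -/
noncomputable def milestonePolicies {n : ℕ} (p : Fin n → ℝ) (N b : ℕ) : Finset (List (Fin n)) :=
  univ.image fun m : Fin N → Fin n => placement p ((List.ofFn m).flatMap (List.replicate b))

theorem card_milestonePolicies_le {n : ℕ} (p : Fin n → ℝ) (N b : ℕ) :
    #(milestonePolicies p N b) ≤ n ^ N :=
  card_image_le.trans (by simp)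

theorem nodup_and_length_le_of_mem_milestonePolicies {n : ℕ} {p : Fin n → ℝ} {N b : ℕ}
    {σ : List (Fin n)} (hσ : σ ∈ milestonePolicies p N b) : σ.Nodup ∧ σ.length ≤ N * b := by
  simp only [milestonePolicies, mem_image, mem_univ, true_and] at hσ
  obtain ⟨m, rfl⟩ := hσ
  refine ⟨nodup_placement _ _, (length_placement_le _ _).trans ?_⟩
  rw [List.length_flatMap_replicate, List.length_ofFn]

theorem placement_mem_milestonePolicies {n : ℕ} (p : Fin n → ℝ) {N b : ℕ} {M : List (Fin n)}
    (hM : M.length = N) :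
    placement p (M.flatMap (List.replicate b)) ∈ milestonePolicies p N b := by
  subst hM
  exact mem_image.2 ⟨M.get, mem_univ _, by rw [List.ofFn_get]⟩

theorem card_milestonePolicies_le_rpow {n : ℕ} (hn : 1 ≤ n) (p : Fin n → ℝ) {N b : ℕ} {y : ℝ}
    (hy : (N : ℝ) ≤ y) : (#(milestonePolicies p N b) : ℝ) ≤ (n : ℝ) ^ y :=
  calc (#(milestonePolicies p N b) : ℝ) ≤ ((n ^ N : ℕ) : ℝ) :=
        mod_cast card_milestonePolicies_le p N b
    _ = (n : ℝ) ^ (N : ℝ) := by push_cast; rw [Real.rpow_natCast]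
    _ ≤ (n : ℝ) ^ y := Real.rpow_le_rpow_of_exponent_le (mod_cast hn) hy

theorem le_mul_of_batches {ε δ : ℝ} (hδ0 : 0 < δ) (hδ1 : δ ≤ 1) (hδε : δ ≤ ε) {Q b a i : ℕ}
    (hQ : 4 / δ ≤ Q) (hb : ((Q + 1 : ℕ) : ℝ) * b ≤ δ / 4 * a) (hb0 : 0 < b) (hai : a ≤ i) :
    (i : ℝ) ≤ (1 + ε) * (((((i - 1) / ((Q + 1) * b)) * (Q * b) : ℕ) : ℝ) + 1) := by
  set L := (Q + 1) * b with hL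
  set j := (i - 1) / L with hj
  have hL0 : 0 < L := by positivity
  have h1 : (i : ℝ) ≤ j * L + L := by
    have : i - 1 < L * (j + 1) := Nat.lt_mul_div_succ _ hL0
    have : i ≤ j * L + L := by nlinarith [(by omega : i ≤ L * (j + 1))]
    exact_mod_cast this
  have hLi : (L : ℝ) ≤ δ / 4 * i := by
    rw [hL]; push_cast at hb ⊢
    exact hb.trans (by gcongr)
  have hQ' : 4 ≤ δ * Q := by
    rw [div_le_iff₀ hδ0] at hQ
    linarith
  have hi0 : (0 : ℝ) ≤ i := by positivity
  have h2 : ((j * (Q * b) : ℕ) : ℝ) ≥ (1 - δ / 4) * (j * L) := by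
    rw [hL]; push_cast
    have : (0 : ℝ) ≤ j * b := by positivity
    nlinarith
  have h3 : (i : ℝ) * (1 - δ / 4) ≤ j * L := by linarith
  have h4 : (1 - δ / 2) * (i : ℝ) ≤ ((j * (Q * b) : ℕ) : ℝ) := by
    nlinarith [mul_le_mul_of_nonneg_left h3 (by linarith : 0 ≤ 1 - δ / 4),
      mul_nonneg (sq_nonneg δ) hi0]
  have h5 : (i : ℝ) ≤ (1 + δ) * ((1 - δ / 2) * i) := by
    nlinarith [mul_nonneg (mul_nonneg hδ0.le (sub_nonneg.2 hδ1)) hi0]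
  calc (i : ℝ) ≤ (1 + δ) * ((1 - δ / 2) * i) := h5
    _ ≤ (1 + δ) * (((j * (Q * b) : ℕ) : ℝ) + 1) := by gcongr; linarith
    _ ≤ _ := by gcongr

/-- For every `ε > 0` there is a constant `C(ε) > 0` such that for all
`1 ≤ k ≤ n`, every monotone probability vector `p ∈ (0,1)^n`, and all `1 ≤ a < a' ≤ n`,
there is a family `Π` of partial non-adaptive policies of length at most `a'` with
`|Π| ≤ n^{C(ε)·a'/a}` such that for every non-adaptive policy `π*` there is a `π ∈ Π` with
`Pr[cost(π) ≥ i] ≤ Pr[(1+ε)·cost(π*) ≥ i]` for every integer `i` with `a ≤ i ≤ a'`. -/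
theorem stmt_16 (ε : ℝ) (hε : 0 < ε) :
    ∃ C : ℝ, 0 < C ∧
      ∀ (n k : ℕ), 1 ≤ k → k ≤ n →
        ∀ p : Fin n → ℝ, (∀ i, 0 < p i ∧ p i < 1) →
          (∀ i j : Fin n, i ≤ j → p i ≤ p j) →
          ∀ a a' : ℕ, 1 ≤ a → a < a' → a' ≤ n →
            ∃ Pi : Finset (List (Fin n)),
              (∀ σ ∈ Pi, σ.Nodup ∧ σ.length ≤ a') ∧
              ((Pi.card : ℝ) ≤ (n : ℝ) ^ (C * (a' : ℝ) / (a : ℝ))) ∧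
              ∀ πstar : List (Fin n), πstar.Nodup → πstar.length = n →
                ∃ π ∈ Pi, ∀ i : ℕ, a ≤ i → i ≤ a' →
                  pr p (fun x => i ≤ cost n k π x) ≤
                    pr p (fun x => (i : ℝ) ≤ (1 + ε) * (cost n k πstar x : ℝ)) := by
  obtain ⟨δ, hδ0, hδ1, hδε⟩ : ∃ δ : ℝ, 0 < δ ∧ δ ≤ 1 ∧ δ ≤ ε :=
    ⟨min ε 1, lt_min hε one_pos, min_le_right _ _, min_le_left _ _⟩
  obtain ⟨Q, hQ⟩ := exists_nat_ge (4 / δ)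
  have hQ0 : 0 < Q := Nat.cast_pos.1 ((by positivity : 0 < 4 / δ).trans_le hQ)
  obtain ⟨K, hK⟩ : ∃ K : ℝ, K = 4 * ((Q + 1 : ℕ) : ℝ) / δ := ⟨_, rfl⟩
  have hK0 : 0 < K := by rw [hK]; positivity
  refine ⟨2 * K, by positivity, fun n k _ _ p hp _ a a' ha haa' ha'n => ?_⟩
  have ha0 : (0 : ℝ) < a := Nat.cast_pos.2 ha
  have hε0 : 0 ≤ 1 + ε := by linarith
  rcases lt_or_ge (a : ℝ) K with haK | haK
  · refine ⟨milestonePolicies p a' 1, fun σ hσ => ?_, ?_, fun τ hτ hτn => ?_⟩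
    · simpa using nodup_and_length_le_of_mem_milestonePolicies hσ
    · refine card_milestonePolicies_le_rpow (by omega) p ?_
      rw [le_div_iff₀ ha0, mul_comm]
      gcongr
      linarith
    · have hrep : List.replicate 1 = fun i : Fin n => [i] := by ext1; rfl
      refine ⟨_, placement_mem_milestonePolicies p (b := 1) (M := τ.take a')
        (by rw [List.length_take]; omega), fun i hai hia' => ?_⟩
      have hsplit : τ.take a' = τ.take (i - 1) ++ (τ.take a').drop (i - 1) := by
        conv_lhs => rw [← List.take_append_drop (i - 1) (τ.take a')]
        rw [List.take_take, min_eq_left (by omega)]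
      rw [hrep, List.flatMap_singleton', hsplit]
      refine pr_cost_placement_le hp hτ (m := i - 1) hε0 (by omega) (fun _ _ => le_rfl)
        (by rw [List.length_take]; omega) ?_
      rw [Nat.cast_sub (by omega)]
      push_cast
      nlinarith [(Nat.cast_nonneg i : (0 : ℝ) ≤ i)]
  · obtain ⟨b, hb⟩ : ∃ b : ℕ, b = ⌊(a : ℝ) / K⌋₊ := ⟨_, rfl⟩
    have hb0 : 0 < b := by rw [hb, Nat.floor_pos]; exact (one_le_div hK0).2 haK
    have hba : (b : ℝ) * K ≤ a := by
      rw [← le_div_iff₀ hK0, hb]; exact Nat.floor_le (by positivity)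
    have hab : (a : ℝ) ≤ 2 * K * b := by
      have h1 : (a : ℝ) / K < b + 1 := by rw [hb]; exact Nat.lt_floor_add_one _
      have h2 : (1 : ℝ) ≤ b := by exact_mod_cast hb0
      rw [div_lt_iff₀ hK0] at h1
      nlinarith
    have hbδ : ((Q + 1 : ℕ) : ℝ) * b ≤ δ / 4 * a := by
      have : ((Q + 1 : ℕ) : ℝ) * b = δ / 4 * (b * K) := by rw [hK]; field_simp
      rw [this]
      gcongr
    have hL0 : 0 < (Q + 1) * b := by positivity
    obtain ⟨J, hJ⟩ : ∃ J : ℕ, J = a' / ((Q + 1) * b) := ⟨_, rfl⟩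
    have hJa' : J * ((Q + 1) * b) ≤ a' := by rw [hJ]; exact Nat.div_mul_le_self _ _
    refine ⟨milestonePolicies p (J * (Q + 1)) b, fun σ hσ => ?_, ?_, fun τ hτ hτn => ?_⟩
    · have := nodup_and_length_le_of_mem_milestonePolicies hσ
      exact ⟨this.1, this.2.trans (by rwa [mul_assoc])⟩
    · refine card_milestonePolicies_le_rpow (by omega) p ?_
      rw [le_div_iff₀ ha0]
      have h1 : ((J * (Q + 1) : ℕ) : ℝ) * b ≤ a' := by
        rw [← mul_assoc] at hJa'
        exact_mod_cast hJa'
      calc ((J * (Q + 1) : ℕ) : ℝ) * a ≤ ((J * (Q + 1) : ℕ) : ℝ) * (2 * K * b) := by gcongr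
        _ = 2 * K * (((J * (Q + 1) : ℕ) : ℝ) * b) := by ring
        _ ≤ 2 * K * a' := by gcongr
    · have hQL : Q * b ≤ (Q + 1) * b := Nat.mul_le_mul_right _ (Nat.le_succ Q)
      obtain ⟨M, hM, hdom⟩ := exists_batch_milestones p hb0 hQ0 τ J
        (by rw [hτn]; exact (Nat.mul_le_mul_left J hQL).trans (hJa'.trans ha'n))
      refine ⟨_, placement_mem_milestonePolicies p (b := b) hM, fun i hai hia' => ?_⟩
      have hj := le_mul_of_batches hδ0 hδ1 hδε hQ hbδ hb0 hai
      have hjL : (i - 1) / ((Q + 1) * b) * ((Q + 1) * b) ≤ i - 1 := Nat.div_mul_le_self _ _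
      have hjJ : (i - 1) / ((Q + 1) * b) ≤ J := by rw [hJ]; exact Nat.div_le_div_right (by omega)
      generalize (i - 1) / ((Q + 1) * b) = j at hj hjL hjJ
      rw [← List.take_append_drop (j * (Q + 1)) M, List.flatMap_append]
      refine pr_cost_placement_le hp hτ hε0 ?_ (hdom j hjJ) ?_ hj
      · have := Nat.mul_le_mul_left j hQL
        omega
      · rw [List.length_flatMap_replicate, List.length_take]
        have := Nat.mul_le_mul_right b (min_le_left (j * (Q + 1)) M.length)
        rw [mul_assoc] at this
        omega
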